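/- arXiv:2003.03899 — 2 statements merged into one kernel-verified Lean document; each statement's English description precedes it below -/
import Mathlib

section
/- Let (A, d_A) be a differential algebra of weight λ and (V, d_V) a bimodule over it. Then (C^*_Diff(A,V), ∂_Diff) is a cochain complex; that is, ∂_Diff ∘ ∂_Diff = 0 in each degree. -/
/-!
STATEMENT 4: Theorem 3.6 of the paper.

`(C^*_Diff(A,V), ∂_Diff)` is a cochain complex, i.e. `∂_Diff ∘ ∂_Diff = 0` in each
degree, where `∂_Diff(f, g) = (∂ f, ∂_lam g + (-1)^n δ f)` for
`(f, g) ∈ C^n_alg(A,V) ⊕ C^{n-1}_DO(dA,dV)` (n ≥ 1) and `∂_Diff v = (∂ v, δ v)` for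
`v ∈ C^0_Diff(A,V) = V`.
-/

open Finset

/-- Apply `d` to the arguments whose index lies in `S`. -/
def dApp {A : Type*} {m : ℕ} (d : A → A) (S : Finset (Fin m)) (x : Fin m → A) :
    Fin m → A :=
  fun i => if i ∈ S then d (x i) else x i

/-- Merge the arguments in positions `j` and `j+1` (0-indexed) by multiplication. -/
def mulAt {A : Type*} [Mul A] {n : ℕ} (x : Fin (n + 1) → A) (j : Fin n) : Fin n → A :=
  fun i =>
    if i.1 < j.1 then x i.castSucc
    else if i.1 = j.1 then x i.castSucc * x i.succ
    else x i.succ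

/-- The Hochschild coboundary with respect to a left action `l` and right action `r`. -/
def hochF {k : Type*} [Field k]
    {A : Type*} [NonUnitalRing A] [Module k A]
    {V : Type*} [AddCommGroup V] [Module k V]
    (l r : A →ₗ[k] V →ₗ[k] V) (n : ℕ) (f : (Fin n → A) → V) :
    (Fin (n + 1) → A) → V :=
  fun x =>
    l (x 0) (f fun i => x i.succ)
      + (∑ j : Fin n, ((-1 : ℤ) ^ (j.1 + 1)) • f (mulAt x j))
      + ((-1 : ℤ) ^ (n + 1)) • r (x (Fin.last n)) (f fun i => x i.castSucc)

/-- The map `δ : C^n_alg(A,V) → C^n_DO(dA,dV)`. -/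
def deltaF {k : Type*} [Field k]
    {A : Type*} [NonUnitalRing A] [Module k A]
    {V : Type*} [AddCommGroup V] [Module k V]
    (lam : k) (dA : A → A) (dV : V → V) (n : ℕ) (f : (Fin n → A) → V) :
    (Fin n → A) → V :=
  fun x =>
    (∑ S ∈ univ.filter fun S : Finset (Fin n) => S.Nonempty,
        lam ^ (S.card - 1) • f (dApp dA S x))
      - dV (f x)

section Faces

/-- The alternating double sum of a family satisfying the cosimplicial identities vanishes. -/
lemma sum_alternating_coface_eq_zero {V : Type*} [AddCommGroup V] (N : ℕ) (G : ℕ → ℕ → V)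
    (hG : ∀ i j, i ≤ j → j ≤ N → G (j + 1) i = G i j) :
    ∑ j ∈ range (N + 2), ∑ i ∈ range (N + 1), ((-1 : ℤ) ^ j) • ((-1 : ℤ) ^ i) • G j i = 0 := by
  rw [← Finset.sum_product']
  refine Finset.sum_involution
    (fun p _ => if p.2 < p.1 then (p.2, p.1 - 1) else (p.2 + 1, p.1)) ?_ ?_ ?_ ?_
  · rintro ⟨j, i⟩ h
    simp only [mem_product, mem_range] at h
    dsimp only
    split_ifs with hij <;> dsimp only
    · obtain ⟨j, rfl⟩ : ∃ m, j = m + 1 := ⟨j - 1, by omega⟩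
      rw [hG i j (by omega) (by omega), smul_smul, smul_smul, Nat.add_sub_cancel,
        ← add_smul]
      convert zero_smul ℤ _ using 2
      ring
    · rw [hG j i (by omega) (by omega), smul_smul, smul_smul, ← add_smul]
      convert zero_smul ℤ _ using 2
      ring
  · rintro ⟨j, i⟩ h -
    dsimp only
    split_ifs <;> simp only [ne_eq, Prod.mk.injEq] <;> omega
  · rintro ⟨j, i⟩ h
    simp only [mem_product, mem_range] at h
    dsimp only
    split_ifs <;> simp only [mem_product, mem_range] <;> omega
  · rintro ⟨j, i⟩ h
    simp only [mem_product, mem_range] at h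
    by_cases hij : i < j
    · have hji : ¬ j - 1 < i := by omega
      simp only [hij, hji, if_true, if_false, Prod.mk.injEq, and_true]
      omega
    · have hji : j < i + 1 := by omega
      simp only [hij, hji, if_true, if_false, Nat.add_sub_cancel]

variable {k : Type*} [Field k] {A : Type*} [NonUnitalRing A] [Module k A]
  {V : Type*} [AddCommGroup V] [Module k V]

/-- The `j`-th coface map of the Hochschild complex. -/
def hochFace (l r : A →ₗ[k] V →ₗ[k] V) (n j : ℕ) (f : (Fin n → A) → V) :
    (Fin (n + 1) → A) → V :=
  fun x =>
    if j = 0 then l (x 0) (f fun i => x i.succ)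
    else if h : j - 1 < n then f (mulAt x ⟨j - 1, h⟩)
    else r (x (Fin.last n)) (f fun i => x i.castSucc)

lemma hochF_eq_sum_hochFace (l r : A →ₗ[k] V →ₗ[k] V) (n : ℕ) (f : (Fin n → A) → V)
    (x : Fin (n + 1) → A) :
    hochF l r n f x = ∑ j ∈ range (n + 2), ((-1 : ℤ) ^ j) • hochFace l r n j f x := by
  rw [Finset.sum_range_succ, Finset.sum_range_succ', ← Fin.sum_univ_eq_sum_range
    (fun j => ((-1 : ℤ) ^ (j + 1)) • hochFace l r n (j + 1) f x)]
  simp [hochF, hochFace, add_comm]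

lemma hochF_sum_smul (l r : A →ₗ[k] V →ₗ[k] V) (n : ℕ) {ι : Type*} (s : Finset ι) (c : ι → ℤ)
    (f : ι → (Fin n → A) → V) (x : Fin (n + 1) → A) :
    hochF l r n (fun y => ∑ i ∈ s, c i • f i y) x = ∑ i ∈ s, c i • hochF l r n (f i) x := by
  simp only [hochF, map_sum, map_zsmul, smul_add, Finset.smul_sum, Finset.sum_add_distrib]
  congr 1
  · congr 1
    rw [Finset.sum_comm]
    simp only [smul_comm (c _)]
  · simp only [smul_comm (c _)]

lemma mulAt_mulAt {n : ℕ} (x : Fin (n + 2) → A) (i j : ℕ) (hij : i ≤ j) (hj : j < n) :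
    mulAt (mulAt x ⟨j + 1, by omega⟩) ⟨i, by omega⟩ =
      mulAt (mulAt x ⟨i, by omega⟩) ⟨j, hj⟩ := by
  ext ⟨m, hm⟩
  simp only [mulAt, Fin.castSucc_mk, Fin.succ_mk]
  split_ifs <;> first | omega | rfl | rw [mul_assoc]

lemma hochFace_hochFace (l r : A →ₗ[k] V →ₗ[k] V)
    (hl : ∀ (x y : A) (v : V), l (x * y) v = l x (l y v))
    (hr : ∀ (x y : A) (v : V), r (x * y) v = r y (r x v))
    (hlr : ∀ (x y : A) (v : V), r y (l x v) = l x (r y v))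
    (n i j : ℕ) (hij : i ≤ j) (hj : j ≤ n + 1) (f : (Fin n → A) → V) (x : Fin (n + 2) → A) :
    hochFace l r (n + 1) (j + 1) (hochFace l r n i f) x =
      hochFace l r (n + 1) i (hochFace l r n j f) x := by
  obtain rfl | hi := Nat.eq_zero_or_pos i
  · obtain rfl | hj0 := Nat.eq_zero_or_pos j
    · simp [hochFace, mulAt, hl]
    · obtain hjn | hjn := Nat.lt_or_ge (j - 1) n
      · have h1 : j < n + 1 := by omega
        have h2 : j ≠ 0 := by omega
        simp only [hochFace, h1, h2, hjn, dif_pos, if_false, if_true, Nat.add_sub_cancel,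
          Nat.add_eq_zero_iff, one_ne_zero, and_false]
        congr 2
        · simp [mulAt, hj0]
        · ext ⟨m, hm⟩
          simp only [mulAt, Fin.castSucc_mk, Fin.succ_mk]
          split_ifs <;> first | omega | rfl
      · obtain rfl : j = n + 1 := by omega
        simp [hochFace, hlr]
  · obtain hjn | hjn := Nat.lt_or_ge (j - 1) n
    · have h1 : j < n + 1 := by omega
      have h2 : j ≠ 0 := by omega
      have h3 : i ≠ 0 := by omega
      have h4 : i - 1 < n := by omega
      have h5 : i - 1 < n + 1 := by omega
      simp only [hochFace, h1, h2, h3, h4, h5, hjn, dif_pos, if_false, Nat.add_sub_cancel,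
        Nat.add_eq_zero_iff, one_ne_zero, and_false]
      rw [← mulAt_mulAt x (i - 1) (j - 1) (by omega) hjn]
      congr 4
      omega
    · obtain rfl : j = n + 1 := by omega
      have h3 : i ≠ 0 := by omega
      have h5 : i - 1 < n + 1 := by omega
      obtain hin | hin := Nat.lt_or_ge (i - 1) n
      · simp only [hochFace, h3, h5, hin, dif_pos, if_false, Nat.add_sub_cancel,
          Nat.add_eq_zero_iff, one_ne_zero, and_false, lt_irrefl, dif_neg, not_false_eq_true]
        congr 2
        · have h6 : ¬ n < i - 1 := by omega
          have h7 : ¬ n = i - 1 := by omega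
          simp [mulAt, h6, h7]
      · obtain rfl : i = n + 1 := by omega
        simp only [hochFace, Nat.add_sub_cancel, Nat.lt_succ_self,
          Nat.add_eq_zero_iff, one_ne_zero, and_false, lt_irrefl, dif_neg, not_false_eq_true,
          if_false, dif_pos]
        have h8 : mulAt x ⟨n, by omega⟩ (Fin.last n) =
            x (Fin.last n).castSucc * x (Fin.last (n + 1)) := by
          simp [mulAt]
        rw [h8, hr]
        congr 3
        ext m
        simp [mulAt, m.2]

lemma hochF_hochF (l r : A →ₗ[k] V →ₗ[k] V)
    (hl : ∀ (x y : A) (v : V), l (x * y) v = l x (l y v))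
    (hr : ∀ (x y : A) (v : V), r (x * y) v = r y (r x v))
    (hlr : ∀ (x y : A) (v : V), r y (l x v) = l x (r y v))
    (n : ℕ) (f : (Fin n → A) → V) :
    hochF l r (n + 1) (hochF l r n f) = 0 := by
  ext x
  have h : hochF l r n f =
      fun y => ∑ j ∈ range (n + 2), ((-1 : ℤ) ^ j) • hochFace l r n j f y :=
    funext (hochF_eq_sum_hochFace l r n f)
  rw [h, hochF_sum_smul]
  simp only [hochF_eq_sum_hochFace, Finset.smul_sum]
  rw [Finset.sum_comm]
  refine Eq.trans (Finset.sum_congr rfl fun j _ => Finset.sum_congr rfl fun i _ => ?_)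
    (sum_alternating_coface_eq_zero (n + 1)
      (fun j i => hochFace l r (n + 1) j (hochFace l r n i f) x)
      fun i j hij hj => hochFace_hochFace l r hl hr hlr n i j hij hj f x)
  exact smul_comm _ _ _

end Faces

section Multilinear

open Function

variable {k : Type*} [Field k] {A : Type*} [NonUnitalRing A] [Module k A]
  [SMulCommClass k A A] [IsScalarTower k A A] {V : Type*} [AddCommGroup V] [Module k V]

lemma exists_mulAt_update {n : ℕ} (x : Fin (n + 1) → A) (i : Fin (n + 1)) (j : Fin n) :
    ∃ (i' : Fin n) (L : A →ₗ[k] A), ∀ a, mulAt (update x i a) j = update (mulAt x j) i' (L a) := by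
  obtain ⟨i, hi⟩ := i
  obtain ⟨j, hj⟩ := j
  obtain h | h | h | h : i < j ∨ i = j ∨ i = j + 1 ∨ j + 1 < i := by omega
  · refine ⟨⟨i, by omega⟩, LinearMap.id, fun a => ?_⟩
    ext ⟨m, hm⟩
    simp only [mulAt, update_apply, Fin.castSucc_mk, Fin.succ_mk, Fin.mk.injEq, LinearMap.id_apply]
    split_ifs <;> first | omega | rfl
  · refine ⟨⟨i, by omega⟩, LinearMap.mulRight k (x ⟨j + 1, by omega⟩), fun a => ?_⟩
    ext ⟨m, hm⟩
    simp only [mulAt, update_apply, Fin.castSucc_mk, Fin.succ_mk, Fin.mk.injEq,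
      LinearMap.mulRight_apply]
    split_ifs <;> first | omega | rfl | (subst_vars; rfl)
  · refine ⟨⟨j, hj⟩, LinearMap.mulLeft k (x ⟨j, by omega⟩), fun a => ?_⟩
    ext ⟨m, hm⟩
    simp only [mulAt, update_apply, Fin.castSucc_mk, Fin.succ_mk, Fin.mk.injEq,
      LinearMap.mulLeft_apply]
    split_ifs <;> first | omega | rfl | (subst_vars; rfl)
  · refine ⟨⟨i - 1, by omega⟩, LinearMap.id, fun a => ?_⟩
    ext ⟨m, hm⟩
    simp only [mulAt, update_apply, Fin.castSucc_mk, Fin.succ_mk, Fin.mk.injEq, LinearMap.id_apply]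
    split_ifs <;> first | omega | rfl

/-- Merging two neighbouring arguments of a multilinear map gives a multilinear map. -/
def MultilinearMap.compMulAt {n : ℕ} (f : MultilinearMap k (fun _ : Fin n => A) V) (j : Fin n) :
    MultilinearMap k (fun _ : Fin (n + 1) => A) V :=
  MultilinearMap.mk' (fun x => f (mulAt x j))
    (fun x i a b => by
      obtain ⟨i', L, h⟩ := exists_mulAt_update (k := k) x i j
      simp only [h, map_add, MultilinearMap.map_update_add])
    (fun x i c a => by
      obtain ⟨i', L, h⟩ := exists_mulAt_update (k := k) x i j
      simp only [h, map_smul, MultilinearMap.map_update_smul])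

lemma exists_multilinear_eq_hochF (l r : A →ₗ[k] V →ₗ[k] V) (n : ℕ)
    (f : MultilinearMap k (fun _ : Fin n => A) V) :
    ∃ F : MultilinearMap k (fun _ : Fin (n + 1) => A) V, ⇑F = hochF l r n f := by
  let P : MultilinearMap k (fun _ : Fin (n + 1) => A) V :=
    LinearMap.uncurryLeft
      { toFun := fun a => (l a).compMultilinearMap f
        map_add' := fun a b => by ext; simp
        map_smul' := fun c a => by ext; simp }
  let Q : MultilinearMap k (fun _ : Fin (n + 1) => A) V :=
    MultilinearMap.uncurryRight (M := fun _ => A) (r.flip.compMultilinearMap f)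
  refine ⟨P + ∑ j : Fin n, ((-1 : ℤ) ^ (j.1 + 1)) • f.compMulAt j + ((-1 : ℤ) ^ (n + 1)) • Q, ?_⟩
  ext x
  simp only [add_apply, _root_.sum_apply, smul_apply]
  rfl

end Multilinear

section Delta

open Function

variable {k : Type*} [Field k] {A : Type*} [NonUnitalRing A] [Module k A]
  {V : Type*} [AddCommGroup V] [Module k V]

lemma smul_deltaF (lam : k) (dA : A →ₗ[k] A) (dV : V →ₗ[k] V) (n : ℕ)
    (f : MultilinearMap k (fun _ : Fin n => A) V) (x : Fin n → A) :
    lam • deltaF lam dA dV n f x =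
      f (fun i => (LinearMap.id + lam • dA : A →ₗ[k] A) (x i)) -
        (LinearMap.id + lam • dV : V →ₗ[k] V) (f x) := by
  have key : f (fun i => (LinearMap.id + lam • dA : A →ₗ[k] A) (x i)) =
      ∑ S : Finset (Fin n), lam ^ S.card • f (dApp dA S x) := by
    have h : (fun i => (LinearMap.id + lam • dA : A →ₗ[k] A) (x i)) =
        (fun i => lam • dA (x i)) + x := by
      ext i
      simp [add_comm]
    rw [h, MultilinearMap.map_add_univ]
    refine Finset.sum_congr rfl fun S _ => ?_
    have h2 : S.piecewise (fun i => lam • dA (x i)) x =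
        S.piecewise (fun i => lam • dApp dA S x i) (dApp dA S x) := by
      ext i
      by_cases hi : i ∈ S <;> simp [hi, dApp]
    rw [h2, MultilinearMap.map_piecewise_smul f (fun _ => lam), Finset.prod_const]
  rw [key, ← Finset.sum_filter_add_sum_filter_not univ (fun S : Finset (Fin n) => S.Nonempty)]
  have hempty : (univ.filter fun S : Finset (Fin n) => ¬ S.Nonempty) = {∅} := by
    ext S
    simp [Finset.not_nonempty_iff_eq_empty]
  have hpow : ∀ S ∈ univ.filter (fun S : Finset (Fin n) => S.Nonempty),
      lam ^ S.card • f (dApp dA S x) = lam • lam ^ (S.card - 1) • f (dApp dA S x) := by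
    intro S hS
    rw [smul_smul, ← pow_succ', Nat.sub_add_cancel]
    exact Finset.card_pos.mpr (Finset.mem_filter.mp hS).2
  rw [hempty, Finset.sum_congr rfl hpow, ← Finset.smul_sum]
  have h0 : dApp dA ∅ x = x := by ext; simp [dApp]
  simp only [deltaF, h0, smul_sub, Finset.sum_singleton, Finset.card_empty, pow_zero, one_smul,
    LinearMap.add_apply, LinearMap.id_apply, LinearMap.smul_apply]
  abel

lemma deltaF_zero_weight (dA : A → A) (dV : V → V) (n : ℕ) (f : (Fin n → A) → V)
    (x : Fin n → A) :
    deltaF (0 : k) dA dV n f x = ∑ i, f (update x i (dA (x i))) - dV (f x) := by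
  have hsub : univ.map ⟨fun i : Fin n => ({i} : Finset (Fin n)), Finset.singleton_injective⟩ ⊆
      univ.filter fun S : Finset (Fin n) => S.Nonempty := by
    intro S hS
    obtain ⟨i, -, rfl⟩ := Finset.mem_map.mp hS
    simp
  unfold deltaF
  rw [← Finset.sum_subset hsub, Finset.sum_map]
  · congr 1
    refine Finset.sum_congr rfl fun i _ => ?_
    have h : dApp dA {i} x = update x i (dA (x i)) := by
      ext j
      by_cases hj : j = i
      · subst hj; simp [dApp]
      · simp [dApp, hj]
    simp [h]
  · intro S hS hS'
    have h1 : S.card ≠ 1 := by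
      intro h
      obtain ⟨i, rfl⟩ := Finset.card_eq_one.mp h
      exact hS' (by simp)
    have h2 : 0 < S.card := Finset.card_pos.mpr (Finset.mem_filter.mp hS).2
    rw [zero_pow (by omega), zero_smul]

/-- Precomposing cochains with a multiplicative map commutes with the Hochschild coboundary. -/
lemma hochF_comp (l r : A →ₗ[k] V →ₗ[k] V) (φ : A →ₗ[k] A) (hφ : ∀ x y, φ (x * y) = φ x * φ y)
    (n : ℕ) (f : (Fin n → A) → V) (x : Fin (n + 1) → A) :
    hochF (l.comp φ) (r.comp φ) n (fun y => f fun i => φ (y i)) x =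
      hochF l r n f fun i => φ (x i) := by
  have h : ∀ j, (fun i => φ (mulAt x j i)) = mulAt (fun i => φ (x i)) j := by
    intro j
    ext i
    simp only [mulAt]
    split_ifs <;> simp [hφ]
  simp only [hochF, h, LinearMap.comp_apply]

/-- Postcomposing cochains with an equivariant map commutes with the Hochschild coboundary. -/
lemma hochF_map (l r l' r' : A →ₗ[k] V →ₗ[k] V) (ψ : V →ₗ[k] V)
    (hl : ∀ x v, ψ (l x v) = l' x (ψ v)) (hr : ∀ x v, ψ (r x v) = r' x (ψ v))
    (n : ℕ) (f : (Fin n → A) → V) (x : Fin (n + 1) → A) :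
    hochF l' r' n (fun y => ψ (f y)) x = ψ (hochF l r n f x) := by
  simp only [hochF, map_add, map_sum, map_zsmul, hl, hr]

lemma hochF_sub (l r : A →ₗ[k] V →ₗ[k] V) (n : ℕ) (f g : (Fin n → A) → V)
    (x : Fin (n + 1) → A) :
    hochF l r n (fun y => f y - g y) x = hochF l r n f x - hochF l r n g x := by
  simp only [hochF, map_sub, smul_sub, Finset.sum_sub_distrib]
  abel

lemma hochF_add (l r : A →ₗ[k] V →ₗ[k] V) (n : ℕ) (f g : (Fin n → A) → V) :
    hochF l r n (f + g) = hochF l r n f + hochF l r n g := by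
  ext x
  simp only [hochF, Pi.add_apply, map_add, smul_add, Finset.sum_add_distrib]
  abel

lemma hochF_zsmul (l r : A →ₗ[k] V →ₗ[k] V) (n : ℕ) (c : ℤ) (f : (Fin n → A) → V) :
    hochF l r n (c • f) = c • hochF l r n f := by
  ext x
  simp only [hochF, Pi.smul_apply, map_zsmul, smul_add, Finset.smul_sum, smul_comm c]

lemma hochF_smul (l r : A →ₗ[k] V →ₗ[k] V) (n : ℕ) (c : k) (f : (Fin n → A) → V)
    (x : Fin (n + 1) → A) :
    hochF l r n (fun y => c • f y) x = c • hochF l r n f x := by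
  simp only [hochF, map_smul, smul_add, Finset.smul_sum, smul_comm c]

/-- For a derivation `d`, inserting `d` in each argument is compatible with merging arguments. -/
lemma sum_mulAt_update (d : A → A) (hd : ∀ x y, d (x * y) = d x * y + x * d y) {n : ℕ}
    (f : MultilinearMap k (fun _ : Fin n => A) V) (x : Fin (n + 1) → A) (j : Fin n) :
    ∑ i, f (mulAt (update x i (d (x i))) j) =
      ∑ i, f (update (mulAt x j) i (d (mulAt x j i))) := by
  rw [Fin.sum_univ_succAbove _ j.castSucc]
  have hne : ∀ i ∈ univ.erase j, f (mulAt (update x (j.castSucc.succAbove i)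
      (d (x (j.castSucc.succAbove i)))) j) = f (update (mulAt x j) i (d (mulAt x j i))) := by
    intro i hi
    congr 1
    obtain ⟨j, hj⟩ := j
    obtain ⟨i, hi'⟩ := i
    have hij : i ≠ j := by simpa [Fin.ext_iff] using hi
    ext ⟨m, hm⟩
    obtain h | h := Nat.lt_or_gt_of_ne hij
    · simp only [mulAt, update_apply, Fin.succAbove, Fin.castSucc_mk, Fin.succ_mk, Fin.mk.injEq,
        Fin.mk_lt_mk, h, if_true]
      split_ifs <;> first | omega | rfl
    · simp only [mulAt, update_apply, Fin.succAbove, Fin.castSucc_mk, Fin.succ_mk, Fin.mk.injEq,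
        Fin.mk_lt_mk, h.not_gt, if_false]
      split_ifs <;> first | omega | rfl
  have h1 : mulAt (update x j.castSucc (d (x j.castSucc))) j =
      update (mulAt x j) j (d (x j.castSucc) * x j.succ) := by
    obtain ⟨j, hj⟩ := j
    ext ⟨m, hm⟩
    simp only [mulAt, update_apply, Fin.castSucc_mk, Fin.succ_mk, Fin.mk.injEq]
    split_ifs <;> first | omega | rfl | (subst_vars; rfl)
  have h2 : mulAt (update x j.succ (d (x j.succ))) j =
      update (mulAt x j) j (x j.castSucc * d (x j.succ)) := by
    obtain ⟨j, hj⟩ := j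
    ext ⟨m, hm⟩
    simp only [mulAt, update_apply, Fin.castSucc_mk, Fin.succ_mk, Fin.mk.injEq]
    split_ifs <;> first | omega | rfl | (subst_vars; rfl)
  have h3 : mulAt x j j = x j.castSucc * x j.succ := by simp [mulAt]
  rw [← Finset.add_sum_erase univ _ (Finset.mem_univ j), Finset.sum_congr rfl hne,
    ← Finset.add_sum_erase univ _ (Finset.mem_univ j), Fin.succAbove_castSucc_self, h1, h2, h3, hd,
    MultilinearMap.map_update_add]
  abel

lemma hochF_deltaF_zero_weight (l r : A →ₗ[k] V →ₗ[k] V) (dA : A →ₗ[k] A) (dV : V →ₗ[k] V)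
    (hdA : ∀ x y : A, dA (x * y) = dA x * y + x * dA y)
    (hdVl : ∀ (x : A) (v : V), dV (l x v) = l (dA x) v + l x (dV v))
    (hdVr : ∀ (x : A) (v : V), dV (r x v) = r (dA x) v + r x (dV v))
    (n : ℕ) (f : MultilinearMap k (fun _ : Fin n => A) V) :
    hochF l r n (deltaF (0 : k) dA dV n f) = deltaF (0 : k) dA dV (n + 1) (hochF l r n f) := by
  ext x
  have hleft : ∑ i, l (update x i (dA (x i)) 0) (f fun m => update x i (dA (x i)) m.succ) =
      l (dA (x 0)) (f fun m => x m.succ) +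
        l (x 0) (∑ i : Fin n, f (update (fun m => x m.succ) i (dA (x i.succ)))) := by
    rw [Fin.sum_univ_succ, map_sum]
    congr 1
    refine Finset.sum_congr rfl fun i _ => ?_
    congr 2
    ext m
    simp [update_apply]
  have hright : ∑ i, r (update x i (dA (x i)) (Fin.last n))
        (f fun m => update x i (dA (x i)) m.castSucc) =
      r (dA (x (Fin.last n))) (f fun m => x m.castSucc) +
        r (x (Fin.last n))
          (∑ i : Fin n, f (update (fun m => x m.castSucc) i (dA (x i.castSucc)))) := by
    rw [Fin.sum_univ_castSucc, map_sum, add_comm]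
    congr 1
    · congr 2
      · simp
      · ext m
        simp [(Fin.castSucc_lt_last m).ne]
    · refine Finset.sum_congr rfl fun i _ => ?_
      congr 2
      · simp [(Fin.castSucc_lt_last i).ne']
      · ext m
        simp [update_apply]
  simp only [deltaF_zero_weight, hochF, Finset.sum_add_distrib, hleft, ← Finset.smul_sum, hright,
    map_add, map_sub, map_sum dV, map_zsmul, hdVl, hdVr, smul_sub, smul_add,
    Finset.sum_sub_distrib]
  rw [Finset.sum_comm]
  simp only [← Finset.smul_sum, sum_mulAt_update dA hdA]
  abel

lemma id_add_smul_map_action (lam : k) (dA : A →ₗ[k] A) (dV : V →ₗ[k] V)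
    (l : A →ₗ[k] V →ₗ[k] V)
    (h : ∀ (x : A) (v : V), dV (l x v) = l (dA x) v + l x (dV v) + lam • l (dA x) (dV v))
    (x : A) (v : V) :
    (LinearMap.id + lam • dV : V →ₗ[k] V) (l x v) =
      (l.comp (LinearMap.id + lam • dA)) x ((LinearMap.id + lam • dV : V →ₗ[k] V) v) := by
  simp only [LinearMap.comp_apply, LinearMap.add_apply, LinearMap.id_apply, LinearMap.smul_apply,
    h, smul_add, map_add, map_smul]
  abel

variable [SMulCommClass k A A] [IsScalarTower k A A]

lemma id_add_smul_map_mul (lam : k) (dA : A →ₗ[k] A)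
    (hdA : ∀ x y : A, dA (x * y) = dA x * y + x * dA y + lam • (dA x * dA y)) (x y : A) :
    (LinearMap.id + lam • dA : A →ₗ[k] A) (x * y) =
      (LinearMap.id + lam • dA : A →ₗ[k] A) x * (LinearMap.id + lam • dA : A →ₗ[k] A) y := by
  simp only [LinearMap.add_apply, LinearMap.id_apply, LinearMap.smul_apply, hdA, smul_add, mul_add,
    add_mul, smul_mul_assoc, mul_smul_comm]
  abel

lemma hochF_deltaF (lam : k) (l r : A →ₗ[k] V →ₗ[k] V) (dA : A →ₗ[k] A) (dV : V →ₗ[k] V)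
    (hdA : ∀ x y : A, dA (x * y) = dA x * y + x * dA y + lam • (dA x * dA y))
    (hdVl : ∀ (x : A) (v : V),
      dV (l x v) = l (dA x) v + l x (dV v) + lam • l (dA x) (dV v))
    (hdVr : ∀ (x : A) (v : V),
      dV (r x v) = r (dA x) v + r x (dV v) + lam • r (dA x) (dV v))
    (n : ℕ) (f : MultilinearMap k (fun _ : Fin n => A) V) :
    hochF (l.comp (LinearMap.id + lam • dA)) (r.comp (LinearMap.id + lam • dA)) n
        (deltaF lam dA dV n f) =
      deltaF lam dA dV (n + 1) (hochF l r n f) := by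
  obtain rfl | hlam := eq_or_ne lam 0
  · simp only [zero_smul, add_zero, LinearMap.comp_id] at *
    exact hochF_deltaF_zero_weight l r dA dV hdA hdVl hdVr n f
  · ext x
    refine smul_right_injective V hlam ?_
    dsimp only
    obtain ⟨F, hF⟩ := exists_multilinear_eq_hochF l r n f
    rw [← hF, smul_deltaF, hF, ← hochF_smul]
    simp only [smul_deltaF]
    rw [hochF_sub, hochF_comp l r _ (id_add_smul_map_mul lam dA hdA),
      hochF_map l r _ _ _ (id_add_smul_map_action lam dA dV l hdVl)
        (id_add_smul_map_action lam dA dV r hdVr)]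

end Delta

theorem differential_cochain_complex_squares_to_zero
    {k : Type*} [Field k] [CharZero k] (lam : k)
    {A : Type*} [NonUnitalRing A] [Module k A] [SMulCommClass k A A] [IsScalarTower k A A]
    {V : Type*} [AddCommGroup V] [Module k V]
    (dA : A →ₗ[k] A)
    (hdA : ∀ x y : A, dA (x * y) = dA x * y + x * dA y + lam • (dA x * dA y))
    (l r : A →ₗ[k] V →ₗ[k] V)
    (hl : ∀ (x y : A) (v : V), l (x * y) v = l x (l y v))
    (hr : ∀ (x y : A) (v : V), r (x * y) v = r y (r x v))
    (hlr : ∀ (x y : A) (v : V), r y (l x v) = l x (r y v))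
    (dV : V →ₗ[k] V)
    (hdVl : ∀ (x : A) (v : V),
      dV (l x v) = l (dA x) v + l x (dV v) + lam • l (dA x) (dV v))
    (hdVr : ∀ (x : A) (v : V),
      dV (r x v) = r (dA x) v + r x (dV v) + lam • r (dA x) (dV v)) :
    -- ∂_Diff (∂_Diff v) = 0 for v ∈ C^0_Diff(A, V) = V
    (∀ v : V,
      hochF l r 1 (hochF l r 0 fun _ => v) = 0 ∧
      hochF (l.comp (LinearMap.id + lam • dA)) (r.comp (LinearMap.id + lam • dA)) 0
            (deltaF lam dA dV 0 fun _ => v)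
          + ((-1 : ℤ) ^ 1) • deltaF lam dA dV 1 (hochF l r 0 fun _ => v)
        = 0) ∧
    -- ∂_Diff (∂_Diff (f, g)) = 0 for
    -- (f, g) ∈ C^{n+1}_Diff(A, V) = C^{n+1}_alg(A,V) ⊕ C^n_DO(dA,dV)
    (∀ (n : ℕ) (f : MultilinearMap k (fun _ : Fin (n + 1) => A) V)
        (g : MultilinearMap k (fun _ : Fin n => A) V),
      hochF l r (n + 2) (hochF l r (n + 1) ⇑f) = 0 ∧
      hochF (l.comp (LinearMap.id + lam • dA)) (r.comp (LinearMap.id + lam • dA)) (n + 1)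
            (hochF (l.comp (LinearMap.id + lam • dA)) (r.comp (LinearMap.id + lam • dA)) n ⇑g
              + ((-1 : ℤ) ^ (n + 1)) • deltaF lam dA dV (n + 1) ⇑f)
          + ((-1 : ℤ) ^ (n + 2)) • deltaF lam dA dV (n + 2) (hochF l r (n + 1) ⇑f)
        = 0) := by
  have hφ := id_add_smul_map_mul lam dA hdA
  have hD := hochF_deltaF lam l r dA dV hdA hdVl hdVr
  refine ⟨fun v => ⟨hochF_hochF l r hl hr hlr 0 _, ?_⟩, fun n f g =>
    ⟨hochF_hochF l r hl hr hlr (n + 1) _, ?_⟩⟩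
  · have h := hD 0 (MultilinearMap.constOfIsEmpty k (fun _ : Fin 0 => A) v)
    have hv : ⇑(MultilinearMap.constOfIsEmpty k (fun _ : Fin 0 => A) v) = fun _ => v := rfl
    rw [hv] at h
    rw [h]
    simp
  · have hl' : ∀ (x y : A) (v : V), (l.comp (LinearMap.id + lam • dA)) (x * y) v =
        (l.comp (LinearMap.id + lam • dA)) x ((l.comp (LinearMap.id + lam • dA)) y v) := by
      intro x y v
      simp only [LinearMap.comp_apply, hφ, hl]
    have hr' : ∀ (x y : A) (v : V), (r.comp (LinearMap.id + lam • dA)) (x * y) v =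
        (r.comp (LinearMap.id + lam • dA)) y ((r.comp (LinearMap.id + lam • dA)) x v) := by
      intro x y v
      simp only [LinearMap.comp_apply, hφ, hr]
    rw [hochF_add, hochF_zsmul, hD, hochF_hochF _ _ hl' hr' (fun x y v => hlr _ _ v),
      zero_add, ← add_smul, pow_succ _ (n + 1)]
    simp
end

section
/- Let (A, d_A) be a differential algebra of weight λ and (V, d_V) a bimodule over it. For any n ≥ 1, f ∈ C^n_alg(A,V) and x_1, …, x_{n+1} ∈ A, the following identity holds: Σ_{k=1}^{n+1} λ^{k−1} Σ_{1≤i_1<⋯<i_k≤n+1} (∂f)^{(i_1,…,i_k)}(x_1,…,x_{n+1}) − d_V(∂f(x_1,…,x_{n+1})) = Σ_{k=1}^n λ^{k−1} Σ_{1≤i_1<⋯<i_k≤n} x_1 ⊢_λ f^{(i_1,…,i_k)}(x_2,…,x_{n+1}) + Σ_{k=1}^n λ^{k−1} Σ_{1≤i_1<⋯<i_k≤n} Σ_{j=1}^n (−1)^j f^{(i_1,…,i_k)}(x_1,…,x_{j−1}, x_j x_{j+1}, x_{j+2},…,x_{n+1}) + (−1)^{n+1} Σ_{k=1}^n λ^{k−1}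 Σ_{1≤i_1<⋯<i_k≤n} f^{(i_1,…,i_k)}(x_1,…,x_n) ⊣_λ x_{n+1} − x_1 ⊢_λ d_V(f(x_2,…,x_{n+1})) + Σ_{j=1}^n (−1)^{j−1} d_V(f(x_1,…,x_{j−1}, x_j x_{j+1}, x_{j+2},…,x_{n+1})) + (−1)^n d_V(f(x_1,…,x_n)) ⊣_λ x_{n+1}. -/
/-!
STATEMENT 18: Lemma A.2 in the appendix of the paper.

The key identity expressing
`Σ_{k=1}^{n+1} λ^{k-1} Σ_{i₁<⋯<i_k} (∂f)^{(i₁,…,i_k)}(x₁,…,x_{n+1}) - dV(∂f(x₁,…,x_{n+1}))`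
in terms of the λ-twisted actions, used in the proof that `δ` is a cochain map.
-/

open Finset

/-- The weight `lam ^ (#S - 1)` of a nonempty set of indices, extended by zero to `∅`. -/
def subsetWeight {k : Type*} [Field k] (lam : k) {ι : Type*} (S : Finset ι) : k :=
  if S.Nonempty then lam ^ (S.card - 1) else 0

theorem sum_filter_nonempty_smul {k : Type*} [Field k] (lam : k)
    {V : Type*} [AddCommGroup V] [Module k V] {ι : Type*} [Fintype ι] [DecidableEq ι]
    (g : Finset ι → V) :
    (∑ S ∈ univ.filter fun S : Finset ι => S.Nonempty, lam ^ (S.card - 1) • g S)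
      = ∑ S, subsetWeight lam S • g S := by
  rw [Finset.sum_filter]
  refine Finset.sum_congr rfl fun S _ => ?_
  unfold subsetWeight
  split_ifs <;> simp

theorem sum_finset_fin_succ {M : Type*} [AddCommMonoid M] {n : ℕ} (p : Fin (n + 1))
    (g : Finset (Fin (n + 1)) → M) :
    ∑ S, g S = ∑ T : Finset (Fin n), g (T.map p.succAboveEmb)
      + ∑ T : Finset (Fin n), g (insert p (T.map p.succAboveEmb)) := by
  have hp : p ∉ (univ : Finset (Fin n)).map p.succAboveEmb := by simp
  have hmap (h : Finset (Fin (n + 1)) → M) :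
      ∑ S ∈ ((univ : Finset (Fin n)).map p.succAboveEmb).powerset, h S
        = ∑ T : Finset (Fin n), h (T.map p.succAboveEmb) := by
    refine (Finset.sum_bij (fun T _ => T.map p.succAboveEmb) ?_ ?_ ?_ ?_).symm
    · intro T _
      simp [Finset.map_subset_map]
    · intro T _ T' _ h
      exact Finset.map_injective _ h
    · intro S hS
      obtain ⟨T, _, rfl⟩ := Finset.subset_map_iff.1 (Finset.mem_powerset.1 hS)
      exact ⟨T, Finset.mem_univ _, rfl⟩
    · intro T _
      rfl
  rw [← Finset.powerset_univ, Fin.univ_succAbove n p, Finset.cons_eq_insert,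
    Finset.sum_powerset_insert hp, hmap, hmap fun S => g (insert p S)]

/-- Splitting a weighted sum over subsets according to whether they contain `p`. -/
theorem sum_subsetWeight_smul_succ {k : Type*} [Field k] (lam : k)
    {V : Type*} [AddCommGroup V] [Module k V] {n : ℕ} (p : Fin (n + 1))
    (g : Finset (Fin (n + 1)) → V) :
    ∑ S, subsetWeight lam S • g S
      = ∑ T : Finset (Fin n), subsetWeight lam T •
          (g (T.map p.succAboveEmb) + lam • g (insert p (T.map p.succAboveEmb)))
        + g {p} := by
  have hmap (T : Finset (Fin n)) :
      subsetWeight lam (T.map p.succAboveEmb) = subsetWeight lam T := by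
    simp [subsetWeight]
  have hinsert (T : Finset (Fin n)) :
      subsetWeight lam (insert p (T.map p.succAboveEmb))
        = subsetWeight lam T * lam + if T = ∅ then 1 else 0 := by
    rcases T.eq_empty_or_nonempty with rfl | hT
    · simp [subsetWeight]
    · have hp : p ∉ T.map p.succAboveEmb := by simp
      simp only [subsetWeight, Finset.insert_nonempty, if_true, hT, hT.ne_empty, if_false,
        Finset.card_insert_of_notMem hp, Finset.card_map, add_zero, Nat.add_sub_cancel]
      rw [← pow_succ, Nat.sub_add_cancel hT.card_pos]
  rw [sum_finset_fin_succ p]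
  simp only [hmap, hinsert, add_smul, smul_add, mul_smul, Finset.sum_add_distrib, ite_smul,
    one_smul, zero_smul, Finset.sum_ite_eq', Finset.mem_univ, if_true, Finset.map_empty,
    insert_empty_eq, add_assoc]

section dApp

variable {A : Type*} {n : ℕ} (d : A → A) (x : Fin (n + 1) → A) (p : Fin (n + 1))
  (T : Finset (Fin n))

theorem dApp_map_succAbove_self : dApp d (T.map p.succAboveEmb) x p = x p := by
  simp [dApp]

theorem dApp_insert_self : dApp d (insert p (T.map p.succAboveEmb)) x p = d (x p) := by
  simp [dApp]

theorem dApp_map_succAbove :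
    (fun i => dApp d (T.map p.succAboveEmb) x (p.succAbove i))
      = dApp d T fun i => x (p.succAbove i) := by
  ext i
  simp [dApp]

theorem dApp_insert_succAbove :
    (fun i => dApp d (insert p (T.map p.succAboveEmb)) x (p.succAbove i))
      = dApp d T fun i => x (p.succAbove i) := by
  ext i
  simp [dApp]

end dApp

/-- Splitting at `p` a weighted sum whose `p`-th argument enters through a bilinear action. -/
theorem sum_subsetWeight_smul_action {k : Type*} [Field k] (lam : k)
    {A : Type*} [NonUnitalRing A] [Module k A] {V : Type*} [AddCommGroup V] [Module k V]
    (dA : A →ₗ[k] A) (a : A →ₗ[k] V →ₗ[k] V) {n : ℕ} (f : (Fin n → A) → V)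
    (x : Fin (n + 1) → A) (p : Fin (n + 1)) :
    ∑ S, subsetWeight lam S •
        a (dApp dA S x p) (f fun i => dApp dA S x (p.succAbove i))
      = ∑ T, subsetWeight lam T •
          a (x p + lam • dA (x p)) (f (dApp dA T fun i => x (p.succAbove i)))
        + a (dA (x p)) (f fun i => x (p.succAbove i)) := by
  rw [sum_subsetWeight_smul_succ lam p]
  have hsingle : (fun i => dApp dA {p} x (p.succAbove i)) = fun i => x (p.succAbove i) := by
    ext i
    simp [dApp]
  have hself : dApp dA {p} x p = dA (x p) := by simp [dApp]
  simp only [dApp_map_succAbove_self, dApp_insert_self, dApp_map_succAbove,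
    dApp_insert_succAbove, hsingle, hself, map_add, map_smul, LinearMap.add_apply,
    LinearMap.smul_apply]

theorem mulAt_dApp {A : Type*} [Mul A] (d : A → A) {n : ℕ} (x : Fin (n + 1) → A) (j : Fin n)
    (S : Finset (Fin (n + 1))) (T : Finset (Fin n))
    (h : ∀ i, i ≠ j → (j.castSucc.succAbove i ∈ S ↔ i ∈ T)) :
    mulAt (dApp d S x) j
      = Function.update (dApp d T (mulAt x j)) j
          (dApp d S x j.castSucc * dApp d S x j.succ) := by
  ext i
  rcases lt_trichotomy i j with hij | rfl | hij
  · have hi := h i hij.ne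
    rw [Fin.succAbove_of_castSucc_lt _ _ (by simpa using hij)] at hi
    rw [Function.update_of_ne hij.ne]
    simp [mulAt, dApp, hi, hij]
  · simp [mulAt]
  · have hi := h i hij.ne'
    rw [Fin.succAbove_of_le_castSucc _ _ (by simpa using hij.le)] at hi
    have h1 : ¬ i < j := hij.not_gt
    have h2 : ¬ i.1 = j.1 := fun e => hij.ne' (Fin.ext e)
    rw [Function.update_of_ne hij.ne']
    simp [mulAt, dApp, hi, h1, h2]

theorem dApp_eq_update {A : Type*} (d : A → A) {n : ℕ} (y : Fin n → A) (j : Fin n)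
    (S T : Finset (Fin n)) (h : ∀ i, i ≠ j → (i ∈ S ↔ i ∈ T)) :
    dApp d S y = Function.update (dApp d T y) j (dApp d S y j) := by
  ext i
  by_cases hij : i = j
  · subst hij
    simp
  · simp [Function.update_of_ne hij, dApp, h i hij]

/-- The weighted sums over subsets are compatible with merging two arguments. -/
theorem sum_subsetWeight_smul_mulAt {k : Type*} [Field k] (lam : k)
    {A : Type*} [NonUnitalRing A] [Module k A] {V : Type*} [AddCommGroup V] [Module k V]
    (dA : A →ₗ[k] A)
    (hdA : ∀ x y : A, dA (x * y) = dA x * y + x * dA y + lam • (dA x * dA y))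
    {n : ℕ} (f : MultilinearMap k (fun _ : Fin n => A) V)
    (x : Fin (n + 1) → A) (j : Fin n) :
    ∑ S, subsetWeight lam S • f (mulAt (dApp dA S x) j)
      = ∑ T, subsetWeight lam T • f (dApp dA T (mulAt x j)) := by
  obtain _ | m := n
  · exact j.elim0
  have hsucc : j.castSucc.succAbove j = j.succ := by simp
  have hne : j.castSucc ≠ j.succ := Fin.castSucc_lt_succ.ne
  have hself : mulAt x j j = x j.castSucc * x j.succ := by simp [mulAt]
  have hmem (T : Finset (Fin (m + 1))) :
      j.succ ∈ T.map j.castSucc.succAboveEmb ↔ j ∈ T := by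
    rw [← hsucc]
    exact Finset.mem_map' _
  have hmap (T : Finset (Fin (m + 1))) (i : Fin (m + 1)) :
      j.castSucc.succAbove i ∈ T.map j.castSucc.succAboveEmb ↔ i ∈ T :=
    Finset.mem_map' j.castSucc.succAboveEmb
  have hleft (T T' : Finset (Fin (m + 1))) (h : ∀ i, i ≠ j → (i ∈ T ↔ i ∈ T')) :
      mulAt (dApp dA (T.map j.castSucc.succAboveEmb) x) j
        = Function.update (dApp dA T' (mulAt x j)) j
          (x j.castSucc * if j ∈ T then dA (x j.succ) else x j.succ) := by
    rw [mulAt_dApp dA x j _ T' fun i hi => by rw [hmap, h i hi]]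
    simp only [dApp_map_succAbove_self]
    simp only [dApp, hmem]
  have hleft' (T T' : Finset (Fin (m + 1))) (h : ∀ i, i ≠ j → (i ∈ T ↔ i ∈ T')) :
      mulAt (dApp dA (insert j.castSucc (T.map j.castSucc.succAboveEmb)) x) j
        = Function.update (dApp dA T' (mulAt x j)) j
          (dA (x j.castSucc) * if j ∈ T then dA (x j.succ) else x j.succ) := by
    rw [mulAt_dApp dA x j _ T' fun i hi => by
      rw [Finset.mem_insert, hmap, h i hi, or_iff_right (Fin.succAbove_ne _ _)]]
    simp only [dApp_insert_self]
    simp only [dApp, Finset.mem_insert, hmem, hne.symm, false_or]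
  have hright (T T' : Finset (Fin (m + 1))) (h : ∀ i, i ≠ j → (i ∈ T ↔ i ∈ T')) :
      dApp dA T (mulAt x j) = Function.update (dApp dA T' (mulAt x j)) j
        (if j ∈ T then dA (x j.castSucc * x j.succ) else x j.castSucc * x j.succ) := by
    rw [dApp_eq_update dA _ j T T' h]
    simp only [dApp, hself]
  have hinsert (T : Finset (Fin m)) (i : Fin (m + 1)) (hi : i ≠ j) :
      i ∈ insert j (T.map j.succAboveEmb) ↔ i ∈ T.map j.succAboveEmb := by
    simp only [Finset.mem_insert, hi, false_or]
  have hsingle (i : Fin (m + 1)) (hi : i ≠ j) :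
      i ∈ ({j} : Finset (Fin (m + 1))) ↔ i ∈ (∅ : Finset (Fin (m + 1))) := by
    simp [hi]
  have hj (T : Finset (Fin m)) : j ∉ T.map j.succAboveEmb := by simp
  have hcast : mulAt (dApp dA {j.castSucc} x) j = Function.update (dApp dA ∅ (mulAt x j)) j
      (dA (x j.castSucc) * x j.succ) := by
    simpa using hleft' ∅ ∅ fun _ _ => Iff.rfl
  rw [sum_subsetWeight_smul_succ lam j.castSucc, sum_subsetWeight_smul_succ lam j,
    sum_subsetWeight_smul_succ lam j, hcast, hleft _ _ hsingle, hleft' _ _ hsingle,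
    hright _ _ hsingle, add_assoc]
  congr 1
  · refine Finset.sum_congr rfl fun T _ => ?_
    rw [hright (T.map j.succAboveEmb) _ fun _ _ => Iff.rfl, hright _ _ (hinsert T),
      hleft (T.map j.succAboveEmb) _ fun _ _ => Iff.rfl, hleft _ _ (hinsert T),
      hleft' (T.map j.succAboveEmb) _ fun _ _ => Iff.rfl, hleft' _ _ (hinsert T)]
    simp only [hj, Finset.mem_insert_self, if_true, if_false, hdA,
      f.map_update_add, f.map_update_smul]
    module
  · simp only [Finset.mem_singleton, if_true, hdA, f.map_update_add, f.map_update_smul]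
    module

theorem coboundary_delta_identity
    {k : Type*} [Field k] [CharZero k] (lam : k)
    {A : Type*} [NonUnitalRing A] [Module k A] [SMulCommClass k A A] [IsScalarTower k A A]
    {V : Type*} [AddCommGroup V] [Module k V]
    (dA : A →ₗ[k] A)
    (hdA : ∀ x y : A, dA (x * y) = dA x * y + x * dA y + lam • (dA x * dA y))
    (l r : A →ₗ[k] V →ₗ[k] V)
    (hl : ∀ (x y : A) (v : V), l (x * y) v = l x (l y v))
    (hr : ∀ (x y : A) (v : V), r (x * y) v = r y (r x v))
    (hlr : ∀ (x y : A) (v : V), r y (l x v) = l x (r y v))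
    (dV : V →ₗ[k] V)
    (hdVl : ∀ (x : A) (v : V),
      dV (l x v) = l (dA x) v + l x (dV v) + lam • l (dA x) (dV v))
    (hdVr : ∀ (x : A) (v : V),
      dV (r x v) = r (dA x) v + r x (dV v) + lam • r (dA x) (dV v))
    (n : ℕ) (hn : 1 ≤ n)
    (f : MultilinearMap k (fun _ : Fin n => A) V)
    (x : Fin (n + 1) → A) :
    -- Σ_{k=1}^{n+1} λ^{k-1} Σ_{1≤i₁<⋯<i_k≤n+1} (∂f)^{(i₁,…,i_k)}(x₁,…,x_{n+1})
    --   - dV (∂f (x₁,…,x_{n+1}))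
    (∑ S ∈ univ.filter fun S : Finset (Fin (n + 1)) => S.Nonempty,
        lam ^ (S.card - 1) • hochF l r n (⇑f) (dApp dA S x))
      - dV (hochF l r n (⇑f) x)
    =
    -- Σ_{k=1}^n λ^{k-1} Σ_{1≤i₁<⋯<i_k≤n} x₁ ⊢_λ f^{(i₁,…,i_k)}(x₂,…,x_{n+1})
    (∑ S ∈ univ.filter fun S : Finset (Fin n) => S.Nonempty,
      lam ^ (S.card - 1) •
        l (x 0 + lam • dA (x 0)) (f (dApp dA S fun i => x i.succ)))
    -- + Σ_{k=1}^n λ^{k-1} Σ_{1≤i₁<⋯<i_k≤n} Σ_{j=1}^n (-1)^j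
    --     f^{(i₁,…,i_k)}(x₁,…,x_j x_{j+1},…,x_{n+1})
    + (∑ S ∈ univ.filter fun S : Finset (Fin n) => S.Nonempty,
      lam ^ (S.card - 1) •
        ∑ j : Fin n, ((-1 : ℤ) ^ (j.1 + 1)) • f (dApp dA S (mulAt x j)))
    -- + (-1)^{n+1} Σ_{k=1}^n λ^{k-1} Σ_{1≤i₁<⋯<i_k≤n}
    --     f^{(i₁,…,i_k)}(x₁,…,x_n) ⊣_λ x_{n+1}
    + ((-1 : ℤ) ^ (n + 1)) •
      (∑ S ∈ univ.filter fun S : Finset (Fin n) => S.Nonempty,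
        lam ^ (S.card - 1) •
          r (x (Fin.last n) + lam • dA (x (Fin.last n)))
            (f (dApp dA S fun i => x i.castSucc)))
    -- - x₁ ⊢_λ dV (f (x₂,…,x_{n+1}))
    - l (x 0 + lam • dA (x 0)) (dV (f fun i => x i.succ))
    -- + Σ_{j=1}^n (-1)^{j-1} dV (f (x₁,…,x_j x_{j+1},…,x_{n+1}))
    + (∑ j : Fin n, ((-1 : ℤ) ^ j.1) • dV (f (mulAt x j)))
    -- + (-1)^n dV (f (x₁,…,x_n)) ⊣_λ x_{n+1}
    + ((-1 : ℤ) ^ n) •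
        r (x (Fin.last n) + lam • dA (x (Fin.last n)))
          (dV (f fun i => x i.castSucc)) := by
  have hleft := sum_subsetWeight_smul_action lam dA l f x 0
  have hright := sum_subsetWeight_smul_action lam dA r f x (Fin.last n)
  have hmul := sum_subsetWeight_smul_mulAt lam dA hdA f x
  simp only [Fin.succAbove_zero, Fin.succAbove_last] at hleft hright
  have hcob : ∑ S, subsetWeight lam S • hochF l r n f (dApp dA S x)
      = ∑ S, subsetWeight lam S • l (dApp dA S x 0) (f fun i => dApp dA S x i.succ)
        + ∑ j : Fin n, ((-1 : ℤ) ^ (j.1 + 1)) •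
            ∑ S, subsetWeight lam S • f (mulAt (dApp dA S x) j)
        + ((-1 : ℤ) ^ (n + 1)) • ∑ S, subsetWeight lam S •
            r (dApp dA S x (Fin.last n)) (f fun i => dApp dA S x i.castSucc) := by
    simp only [hochF, smul_add, Finset.sum_add_distrib, Finset.smul_sum,
      smul_comm _ (subsetWeight lam _)]
    rw [Finset.sum_comm]
  have hmid : ∑ S, subsetWeight lam S •
        ∑ j : Fin n, ((-1 : ℤ) ^ (j.1 + 1)) • f (dApp dA S (mulAt x j))
      = ∑ j : Fin n, ((-1 : ℤ) ^ (j.1 + 1)) •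
          ∑ S, subsetWeight lam S • f (dApp dA S (mulAt x j)) := by
    simp only [Finset.smul_sum, smul_comm _ (subsetWeight lam _)]
    rw [Finset.sum_comm]
  simp only [sum_filter_nonempty_smul]
  rw [hcob, hmid, hleft, hright]
  simp only [hmul, hochF, map_add, map_sum, map_neg, map_zsmul, hdVl, hdVr, map_smul,
    LinearMap.add_apply, LinearMap.smul_apply, pow_succ, mul_neg, mul_one, neg_smul,
    Finset.sum_neg_distrib, smul_add]
  abel
end
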